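/- arXiv:1612.02775 — 2 statements merged into one kernel-verified Lean document; each statement's English description precedes it below -/
import Mathlib

section
/- For every ν = (ν₁,ν₂) ∈ S¹ the limit φ_sl(ν) = lim_{t→∞} (1/t)·inf{E_sl(u, Q_ν(0,t)) : u : ℤ² → {−1,1}, u(x) = u_{0,ν}(x) whenever dist(x, ∂Q_ν(0,t)) ≤ 2} exists and equals 2(c(e₁)+c(−e₁))|ν₁| + 2(c(e₂)+c(−e₂))|ν₂|. -/
open scoped ENNReal Classical
open Filter

/-- The canonical embedding of `ℤ³` into Euclidean `ℝ³`. -/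
noncomputable def toR3 (x : ℤ × ℤ × ℤ) : EuclideanSpace ℝ (Fin 3) :=
  (WithLp.equiv 2 (Fin 3 → ℝ)).symm ![(x.1 : ℝ), (x.2.1 : ℝ), (x.2.2 : ℝ)]

/-- The canonical embedding of `ℤ²` into Euclidean `ℝ²`. -/
noncomputable def toR2 (x : ℤ × ℤ) : EuclideanSpace ℝ (Fin 2) :=
  (WithLp.equiv 2 (Fin 2 → ℝ)).symm ![(x.1 : ℝ), (x.2 : ℝ)]

/-- The projection `P₂ : ℤ³ → ℤ²` onto the first two coordinates. -/
def P2z (x : ℤ × ℤ × ℤ) : ℤ × ℤ := (x.1, x.2.1)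

/-- The rotation of `ν` by `π/2`, giving the second side direction of the square `Q_ν`. -/
noncomputable def rotDir (ν : EuclideanSpace ℝ (Fin 2)) : EuclideanSpace ℝ (Fin 2) :=
  (WithLp.equiv 2 (Fin 2 → ℝ)).symm ![-(ν 1), ν 0]

/-- The open square `Q_ν(0,t) ⊂ ℝ²` centered at `0` with side length `t` and one pair of
sides orthogonal to `ν`. -/
noncomputable def sqQ (ν : EuclideanSpace ℝ (Fin 2)) (t : ℝ) :
    Set (EuclideanSpace ℝ (Fin 2)) :=
  {x | |@inner ℝ _ _ x ν| < t / 2 ∧ |@inner ℝ _ _ x (rotDir ν)| < t / 2}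

/-- The jump configuration `u_{0,ν}`: equal to `1` where `⟨x,ν⟩ ≥ 0` and `-1` elsewhere. -/
noncomputable def u0 (ν : EuclideanSpace ℝ (Fin 2)) (x : EuclideanSpace ℝ (Fin 2)) : ℝ :=
  if 0 ≤ @inner ℝ _ _ x ν then 1 else -1

/-- The slice energy `E_sl(u,A)`: sum of `c(x-y)|u(x)-u(y)|` over nearest-neighbour pairs
`x, y ∈ ℤ² ∩ A` (i.e. with `|x-y| = 1`). -/
noncomputable def Esl (c : EuclideanSpace ℝ (Fin 2) → ℝ) (u : ℤ × ℤ → ℝ)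
    (A : Set (EuclideanSpace ℝ (Fin 2))) : ℝ≥0∞ :=
  ∑' x : ℤ × ℤ, ∑' y : ℤ × ℤ,
    if toR2 x ∈ A ∧ toR2 y ∈ A ∧ ‖toR2 x - toR2 y‖ = 1 then
      ENNReal.ofReal (c (toR2 x - toR2 y) * |u x - u y|) else 0

/-- The minimum value of the slice energy on `Q_ν(0,t)` with boundary datum `u_{0,ν}`
on a boundary layer of width `2`. -/
noncomputable def mSl (c : EuclideanSpace ℝ (Fin 2) → ℝ)
    (ν : EuclideanSpace ℝ (Fin 2)) (t : ℝ) : ℝ :=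
  (⨅ u : {u : ℤ × ℤ → ℝ //
      (∀ x, u x = 1 ∨ u x = -1) ∧
      ∀ x : ℤ × ℤ, Metric.infDist (toR2 x) (frontier (sqQ ν t)) ≤ 2 →
        u x = u0 ν (toR2 x)},
    Esl c u (sqQ ν t)).toReal
/-- Total variation, along all horizontal bonds with both endpoints in `P`, of a configuration
`v` on the lattice `ℤ²`; the second argument indexes the rows. -/
noncomputable def rowVariation (P : ℤ → ℤ → Prop) (v : ℤ → ℤ → ℝ) : ℝ≥0∞ :=
  ∑' h : ℤ, ∑' x : ℤ,
    if P x h ∧ P (x + 1) h then ENNReal.ofReal |v x h - v (x + 1) h| else 0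

/-- The lattice points of the rotated square of side `t` with normal `(a, b)`. -/
def latticeSquare (a b t : ℝ) (x h : ℤ) : Prop :=
  |a * x + b * h| < t / 2 ∧ |-b * x + a * h| < t / 2

/-- The lattice half-plane configuration with normal `(a, b)`. -/
noncomputable def halfPlane (a b : ℝ) (x h : ℤ) : ℝ :=
  if 0 ≤ a * x + b * h then 1 else -1

theorem exists_ne_succ_of_ne {f : ℤ → ℝ} {m : ℤ} (k : ℕ) (hf : f m ≠ f (m + k)) :
    ∃ i, m ≤ i ∧ i < m + k ∧ f i ≠ f (i + 1) := by
  induction k with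
  | zero => simp at hf
  | succ k ih =>
    by_cases h : f m = f (m + k)
    · refine ⟨m + k, by omega, by push_cast; omega, ?_⟩
      rw [← h, add_assoc]
      exact_mod_cast hf
    · obtain ⟨i, h1, h2, h3⟩ := ih h
      exact ⟨i, h1, by push_cast; omega, h3⟩

/-- Starting in a proper region, one can walk along `ℕ` until the last point before the exit. -/
theorem exists_last_of_not {p : ℕ → Prop} (h0 : p 0) (hex : ∃ n, ¬ p n) :
    ∃ k, (∀ i ≤ k, p i) ∧ ¬ p (k + 1) := by
  have hne : Nat.find hex ≠ 0 := fun h => by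
    have := Nat.find_spec hex
    rw [h] at this
    exact this h0
  obtain ⟨k, hk⟩ := Nat.exists_eq_succ_of_ne_zero hne
  refine ⟨k, fun i hi => ?_, ?_⟩
  · exact not_not.1 (Nat.find_min hex (m := i) (by omega))
  · have := Nat.find_spec hex
    rwa [hk] at this

theorem latticeSquare.abs_fst_le {a b t : ℝ} (hab : a ^ 2 + b ^ 2 = 1) {x h : ℤ}
    (hP : latticeSquare a b t x h) : |(x : ℝ)| < t := by
  obtain ⟨h1, h2⟩ := hP
  have ha : |a| ≤ 1 := by rw [abs_le_one_iff_mul_self_le_one]; nlinarith [sq_nonneg b]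
  have hb : |b| ≤ 1 := by rw [abs_le_one_iff_mul_self_le_one]; nlinarith [sq_nonneg a]
  have e : (x : ℝ) = a * (a * x + b * h) - b * (-b * x + a * h) := by
    linear_combination (-(x : ℝ)) * hab
  have h3 : |(x : ℝ)| ≤ |a| * |a * x + b * h| + |b| * |-b * x + a * h| := by
    conv_lhs => rw [e]
    rw [← abs_mul, ← abs_mul]
    exact abs_sub _ _
  nlinarith [abs_nonneg (a * x + b * h), abs_nonneg (-b * x + a * h)]

/-- A point of a row at distance at most one from the crossing with the interface lies in the
square, provided the row is not too high. -/
theorem latticeSquare_of_near {a b t : ℝ} (hab : a ^ 2 + b ^ 2 = 1) (ha0 : a ≠ 0)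
    (ht : 2 < t) {x h : ℤ} (hh : |(h : ℝ)| ≤ |a| * t / 2 - 2)
    (hx : |(x : ℝ) - -b * h / a| ≤ 1) : latticeSquare a b t x h := by
  have ha : |a| ≤ 1 := by rw [abs_le_one_iff_mul_self_le_one]; nlinarith [sq_nonneg b]
  have hb : |b| ≤ 1 := by rw [abs_le_one_iff_mul_self_le_one]; nlinarith [sq_nonneg a]
  have hapos : 0 < |a| := abs_pos.2 ha0
  have e1 : a * x + b * h = a * ((x : ℝ) - -b * h / a) := by field_simp; ring
  have e2 : -b * x + a * h = h / a - b * ((x : ℝ) - -b * h / a) := by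
    field_simp
    linear_combination (h : ℝ) * hab
  constructor
  · rw [e1, abs_mul]
    nlinarith [abs_nonneg ((x : ℝ) - -b * h / a)]
  · rw [e2]
    have h1 : |(h : ℝ) / a| < t / 2 - 1 := by
      rw [abs_div, div_lt_iff₀ hapos]
      nlinarith
    have h2 : |b * ((x : ℝ) - -b * h / a)| ≤ 1 := by
      rw [abs_mul]
      nlinarith [abs_nonneg ((x : ℝ) - -b * h / a), abs_nonneg b]
    have h3 := abs_sub ((h : ℝ) / a) (b * ((x : ℝ) - -b * h / a))
    linarith

theorem two_le_row_tsum {a b t : ℝ} (hab : a ^ 2 + b ^ 2 = 1) (ha0 : a ≠ 0) (ht : 2 < t)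
    {v : ℤ → ℤ → ℝ} (hv : ∀ x h, v x h = 1 ∨ v x h = -1)
    (hbd : ∀ x h, latticeSquare a b t x h →
      (¬ latticeSquare a b t (x + 1) h ∨ ¬ latticeSquare a b t (x - 1) h) →
      v x h = halfPlane a b x h)
    {h : ℤ} (hh : |(h : ℝ)| ≤ |a| * t / 2 - 2) :
    2 ≤ ∑' x : ℤ, if latticeSquare a b t x h ∧ latticeSquare a b t (x + 1) h then
      ENNReal.ofReal |v x h - v (x + 1) h| else 0 := by
  set p : ℝ := -b * h / a with hp
  have hfar : ∀ x : ℤ, t ≤ |(x : ℝ)| → ¬ latticeSquare a b t x h := fun x hx hP =>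
    absurd (hP.abs_fst_le hab) (not_lt.2 hx)
  have hline : ∀ x : ℤ, a * x + b * h = a * (x - p) := fun x => by
    rw [hp]; field_simp; ring
  obtain ⟨k, hk, hk'⟩ : ∃ k : ℕ, (∀ i ≤ k, latticeSquare a b t (⌊p⌋ + 1 + (i : ℕ)) h) ∧
      ¬ latticeSquare a b t (⌊p⌋ + 1 + (k + 1 : ℕ)) h := by
    refine exists_last_of_not (p := fun i : ℕ => latticeSquare a b t (⌊p⌋ + 1 + (i : ℕ)) h) ?_ ?_
    · refine latticeSquare_of_near hab ha0 ht hh (abs_le.2 ?_)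
      push_cast
      constructor <;> linarith [Int.floor_le p, Int.lt_floor_add_one p]
    · obtain ⟨n, hn⟩ := exists_nat_ge (t - (⌊p⌋ + 1 : ℝ))
      refine ⟨n, hfar _ (le_trans ?_ (le_abs_self _))⟩
      push_cast
      linarith
  obtain ⟨l, hl, hl'⟩ : ∃ l : ℕ, (∀ i ≤ l, latticeSquare a b t (⌈p⌉ - 1 - (i : ℕ)) h) ∧
      ¬ latticeSquare a b t (⌈p⌉ - 1 - (l + 1 : ℕ)) h := by
    refine exists_last_of_not (p := fun i : ℕ => latticeSquare a b t (⌈p⌉ - 1 - (i : ℕ)) h) ?_ ?_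
    · refine latticeSquare_of_near hab ha0 ht hh (abs_le.2 ?_)
      push_cast
      constructor <;> linarith [Int.le_ceil p, Int.ceil_lt_add_one p]
    · obtain ⟨n, hn⟩ := exists_nat_ge (t + (⌈p⌉ - 1 : ℝ))
      refine ⟨n, hfar _ (le_trans ?_ (neg_le_abs _))⟩
      push_cast
      linarith
  set n : ℤ := ⌊p⌋ + 1 + k with hn
  set m : ℤ := ⌈p⌉ - 1 - l with hm
  have hpn : p < n := by
    rw [hn]; push_cast
    have := Int.lt_floor_add_one p
    have : (0 : ℝ) ≤ k := k.cast_nonneg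
    linarith
  have hmp : m < p := by
    rw [hm]; push_cast
    have := Int.ceil_lt_add_one p
    have : (0 : ℝ) ≤ l := l.cast_nonneg
    linarith
  have hmn : m ≤ n := by exact_mod_cast (hmp.trans hpn).le
  have hall : ∀ i, m ≤ i → i ≤ n → latticeSquare a b t i h := by
    intro i hi1 hi2
    by_cases c1 : ⌊p⌋ + 1 ≤ i
    · have := hk (i - (⌊p⌋ + 1)).toNat (by omega)
      rwa [Int.toNat_of_nonneg (by omega), add_sub_cancel] at this
    by_cases c2 : i ≤ ⌈p⌉ - 1
    · have := hl (⌈p⌉ - 1 - i).toNat (by omega)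
      rwa [Int.toNat_of_nonneg (by omega), sub_sub_cancel] at this
    have h1 : (i : ℝ) ≤ ⌊p⌋ := by exact_mod_cast (by omega : i ≤ ⌊p⌋)
    have h2 : (⌈p⌉ : ℝ) ≤ i := by exact_mod_cast (by omega : ⌈p⌉ ≤ i)
    refine latticeSquare_of_near hab ha0 ht hh (abs_le.2 ?_)
    constructor <;> linarith [Int.floor_le p, Int.le_ceil p]
  have hvn : v n h = halfPlane a b n h :=
    hbd n h (hall n hmn le_rfl) (Or.inl (by rw [hn]; push_cast at hk'; rwa [add_assoc _ (k : ℤ)]))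
  have hvm : v m h = halfPlane a b m h :=
    hbd m h (hall m le_rfl hmn) (Or.inr (by rw [hm]; push_cast at hl'; rwa [sub_sub _ (l : ℤ)]))
  have hne : v m h ≠ v n h := by
    rw [hvn, hvm, halfPlane, halfPlane, hline, hline]
    rcases lt_or_gt_of_ne ha0 with ha | ha
    · rw [if_pos (by nlinarith), if_neg (by nlinarith)]; norm_num
    · rw [if_neg (by nlinarith), if_pos (by nlinarith)]; norm_num
  obtain ⟨i, hi1, hi2, hi3⟩ := exists_ne_succ_of_ne (f := fun i => v i h) (m := m) (n - m).toNat
    (by rwa [Int.toNat_of_nonneg (by omega), add_sub_cancel])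
  rw [Int.toNat_of_nonneg (by omega), add_sub_cancel] at hi2
  refine le_trans ?_ (ENNReal.le_tsum i)
  rw [if_pos ⟨hall i hi1 hi2.le, hall (i + 1) (by omega) (by omega)⟩]
  have : |v i h - v (i + 1) h| = 2 := by
    rcases hv i h with e | e <;> rcases hv (i + 1) h with e' | e' <;>
      simp only [e, e'] at hi3 ⊢ <;> first | exact absurd rfl hi3 | norm_num
  rw [this]
  simp

theorem le_rowVariation {a b t : ℝ} (hab : a ^ 2 + b ^ 2 = 1) (ht : 2 < t)
    {v : ℤ → ℤ → ℝ} (hv : ∀ x h, v x h = 1 ∨ v x h = -1)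
    (hbd : ∀ x h, latticeSquare a b t x h →
      (¬ latticeSquare a b t (x + 1) h ∨ ¬ latticeSquare a b t (x - 1) h) →
      v x h = halfPlane a b x h) :
    ENNReal.ofReal (2 * (|a| * t - 5)) ≤ rowVariation (latticeSquare a b t) v := by
  rcases eq_or_ne a 0 with rfl | ha0
  · rw [ENNReal.ofReal_of_nonpos (by simp)]
    exact zero_le
  set R : ℝ := |a| * t / 2 - 2 with hR
  refine le_trans ?_ (ENNReal.sum_le_tsum (Finset.Icc ⌈-R⌉ ⌊R⌋))
  have hrow : ∀ h ∈ Finset.Icc ⌈-R⌉ ⌊R⌋, (2 : ℝ≥0∞) ≤ ∑' x : ℤ,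
      if latticeSquare a b t x h ∧ latticeSquare a b t (x + 1) h then
        ENNReal.ofReal |v x h - v (x + 1) h| else 0 := fun h hh => by
    rw [Finset.mem_Icc, Int.ceil_le, Int.le_floor] at hh
    exact two_le_row_tsum hab ha0 ht hv hbd (abs_le.2 hh)
  refine le_trans ?_ (Finset.card_nsmul_le_sum _ _ _ hrow)
  rw [Int.card_Icc, nsmul_eq_mul]
  refine ENNReal.ofReal_le_of_le_toReal ?_
  rw [ENNReal.toReal_mul, ENNReal.toReal_natCast, ENNReal.toReal_ofNat, mul_comm]
  have h1 : ((⌊R⌋ + 1 - ⌈-R⌉ : ℤ) : ℝ) ≤ ((⌊R⌋ + 1 - ⌈-R⌉).toNat : ℝ) := by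
    exact_mod_cast Int.self_le_toNat _
  push_cast at h1
  linarith [Int.lt_floor_add_one R, Int.ceil_lt_add_one (-R)]

/-- Along a bond where the half-plane configuration jumps, the affine function changes sign. -/
theorem halfPlane_ne_iff {a b : ℝ} {x h : ℤ} :
    halfPlane a b x h ≠ halfPlane a b (x + 1) h ↔
      (a * x + b * h < 0 ∧ 0 ≤ a * x + b * h + a) ∨
      (0 ≤ a * x + b * h ∧ a * x + b * h + a < 0) := by
  have e : a * ((x + 1 : ℤ) : ℝ) + b * h = a * x + b * h + a := by push_cast; ring
  unfold halfPlane
  rw [e]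
  split_ifs with h1 h2 h2 <;> simp [h1, h2, not_le.1, not_lt.2] <;> norm_num

theorem halfPlane_jump_not_lt {a b : ℝ} {x y h : ℤ}
    (hx : halfPlane a b x h ≠ halfPlane a b (x + 1) h)
    (hy : halfPlane a b y h ≠ halfPlane a b (y + 1) h) : ¬ x < y := by
  intro hxy
  have h1 : (x : ℝ) + 1 ≤ y := by exact_mod_cast hxy
  rw [halfPlane_ne_iff] at hx hy
  rcases hx with ⟨hx1, hx2⟩ | ⟨hx1, hx2⟩ <;> rcases hy with ⟨hy1, hy2⟩ | ⟨hy1, hy2⟩ <;>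
    nlinarith

theorem rowVariation_halfPlane_le {a b t : ℝ} (hab : a ^ 2 + b ^ 2 = 1) (ht : 0 < t) :
    rowVariation (latticeSquare a b t) (halfPlane a b) ≤
      ENNReal.ofReal (2 * (|a| * t + 3)) := by
  have ha : |a| ≤ 1 := by rw [abs_le_one_iff_mul_self_le_one]; nlinarith [sq_nonneg b]
  have hb : |b| ≤ 1 := by rw [abs_le_one_iff_mul_self_le_one]; nlinarith [sq_nonneg a]
  set R : ℝ := |a| * t / 2 + 1 with hR
  have hR0 : 0 ≤ R := by positivity
  set F : ℤ → ℤ → ℝ≥0∞ := fun h x =>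
    if latticeSquare a b t x h ∧ latticeSquare a b t (x + 1) h then
      ENNReal.ofReal |halfPlane a b x h - halfPlane a b (x + 1) h| else 0 with hF
  have hjump : ∀ h x, F h x ≠ 0 →
      latticeSquare a b t x h ∧ halfPlane a b x h ≠ halfPlane a b (x + 1) h := by
    intro h x hx
    simp only [hF] at hx
    split_ifs at hx with hP
    · refine ⟨hP.1, fun e => hx ?_⟩
      rw [e]; simp
    · exact absurd rfl hx
  have hF2 : ∀ h x, F h x ≤ 2 := by
    intro h x
    simp only [hF]
    split_ifs
    · refine ENNReal.ofReal_le_of_le_toReal ?_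
      rw [ENNReal.toReal_ofNat]
      unfold halfPlane
      split_ifs <;> norm_num
    · exact zero_le
  have hrow2 : ∀ h, ∑' x, F h x ≤ 2 := by
    intro h
    by_cases hex : ∃ x, F h x ≠ 0
    · obtain ⟨x, hx⟩ := hex
      rw [tsum_eq_single x]
      · exact hF2 h x
      · intro y hy
        by_contra hy0
        rcases lt_or_gt_of_ne hy with hlt | hlt
        · exact halfPlane_jump_not_lt (hjump h y hy0).2 (hjump h x hx).2 hlt
        · exact halfPlane_jump_not_lt (hjump h x hx).2 (hjump h y hy0).2 hlt
    · push Not at hex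
      simp [hex]
  have hrow0 : ∀ h, h ∉ Finset.Icc ⌈-R⌉ ⌊R⌋ → ∑' x, F h x = 0 := by
    intro h hh
    rw [ENNReal.tsum_eq_zero]
    intro x
    by_contra hx
    apply hh
    obtain ⟨⟨-, hP⟩, hj⟩ := hjump h x hx
    rw [Finset.mem_Icc, Int.ceil_le, Int.le_floor, ← abs_le]
    have h1 : |a * x + b * h| ≤ 1 := by
      rw [halfPlane_ne_iff] at hj
      rw [abs_le] at ha ⊢
      rcases hj with hj | hj <;> constructor <;> linarith [hj.1, hj.2]
    have e : (h : ℝ) = b * (a * x + b * h) + a * (-b * x + a * h) := by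
      linear_combination (-(h : ℝ)) * hab
    have h3 : |(h : ℝ)| ≤ |b| * |a * x + b * h| + |a| * |-b * x + a * h| := by
      conv_lhs => rw [e]
      rw [← abs_mul, ← abs_mul]
      exact abs_add_le _ _
    nlinarith [abs_nonneg (a * x + b * h), abs_nonneg (-b * x + a * h), abs_nonneg a]
  have : rowVariation (latticeSquare a b t) (halfPlane a b) = ∑' h, ∑' x, F h x := rfl
  rw [this, tsum_eq_sum (fun h hh => hrow0 h hh)]
  refine le_trans (Finset.sum_le_card_nsmul _ _ 2 fun h _ => hrow2 h) ?_
  rw [Int.card_Icc, nsmul_eq_mul]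
  refine ENNReal.le_ofReal_iff_toReal_le (by finiteness) (by positivity) |>.2 ?_
  rw [ENNReal.toReal_mul, ENNReal.toReal_natCast, ENNReal.toReal_ofNat, mul_comm]
  have h0 : 0 ≤ ⌊R⌋ := Int.floor_nonneg.2 hR0
  have h0' : ⌈-R⌉ ≤ 0 := Int.ceil_le.2 (by push_cast; linarith)
  have h1 : ((⌊R⌋ + 1 - ⌈-R⌉).toNat : ℝ) = ((⌊R⌋ + 1 - ⌈-R⌉ : ℤ) : ℝ) := by
    exact_mod_cast Int.toNat_of_nonneg (by omega)
  rw [h1]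
  push_cast
  linarith [Int.floor_le R, Int.le_ceil (-R)]

theorem inner_toR2 (x : ℤ × ℤ) (ν : EuclideanSpace ℝ (Fin 2)) :
    @inner ℝ _ _ (toR2 x) ν = ν 0 * x.1 + ν 1 * x.2 := by
  simp [toR2, PiLp.inner_apply, Fin.sum_univ_two]

theorem toR2_mem_sqQ {ν : EuclideanSpace ℝ (Fin 2)} {t : ℝ} {x : ℤ × ℤ} :
    toR2 x ∈ sqQ ν t ↔ latticeSquare (ν 0) (ν 1) t x.1 x.2 := by
  simp [sqQ, inner_toR2, latticeSquare, rotDir]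

theorem latticeSquare_swap {a b t : ℝ} {x h : ℤ} :
    latticeSquare b a t x h ↔ latticeSquare a b t h x := by
  unfold latticeSquare
  rw [← abs_neg (-a * x + b * h), add_comm (b * (x : ℝ))]
  ring_nf

theorem u0_toR2 (ν : EuclideanSpace ℝ (Fin 2)) (x : ℤ × ℤ) :
    u0 ν (toR2 x) = halfPlane (ν 0) (ν 1) x.1 x.2 := by
  simp [u0, halfPlane, inner_toR2]

theorem halfPlane_swap (a b : ℝ) (x h : ℤ) : halfPlane b a x h = halfPlane a b h x := by
  unfold halfPlane
  rw [add_comm]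

theorem toR2_sub_toR2_add (x d : ℤ × ℤ) : toR2 x - toR2 (x + d) = -toR2 d := by
  ext i
  fin_cases i <;> simp [toR2]

theorem norm_toR2_eq_one_iff {d : ℤ × ℤ} :
    ‖toR2 d‖ = 1 ↔ d ∈ ({(1, 0), (-1, 0), (0, 1), (0, -1)} : Finset (ℤ × ℤ)) := by
  obtain ⟨p, q⟩ := d
  have h1 : ‖toR2 (p, q)‖ = 1 ↔ p ^ 2 + q ^ 2 = 1 := by
    rw [EuclideanSpace.norm_eq, Real.sqrt_eq_one]
    simp only [toR2, Fin.sum_univ_two]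
    simp
    norm_cast
  rw [h1]
  simp only [Finset.mem_insert, Finset.mem_singleton, Prod.mk.injEq]
  constructor
  · intro h
    have hp1 : p ≤ 1 := by nlinarith [sq_nonneg q]
    have hp2 : -1 ≤ p := by nlinarith [sq_nonneg q]
    have hq1 : q ≤ 1 := by nlinarith [sq_nonneg p]
    have hq2 : -1 ≤ q := by nlinarith [sq_nonneg p]
    interval_cases p <;> interval_cases q <;> simp_all
  · rintro (⟨rfl, rfl⟩ | ⟨rfl, rfl⟩ | ⟨rfl, rfl⟩ | ⟨rfl, rfl⟩) <;> norm_num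

/-- The contribution to the slice energy of the bonds `(x, x + d)`, up to the coefficient. -/
noncomputable def bondVariation (u : ℤ × ℤ → ℝ) (A : Set (EuclideanSpace ℝ (Fin 2)))
    (d : ℤ × ℤ) : ℝ≥0∞ :=
  ∑' x : ℤ × ℤ, if toR2 x ∈ A ∧ toR2 (x + d) ∈ A then ENNReal.ofReal |u x - u (x + d)| else 0

theorem bondVariation_neg (u : ℤ × ℤ → ℝ) (A : Set (EuclideanSpace ℝ (Fin 2))) (d : ℤ × ℤ) :
    bondVariation u A (-d) = bondVariation u A d := by
  unfold bondVariation
  rw [← (Equiv.addRight d).tsum_eq]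
  refine tsum_congr fun x => ?_
  simp only [Equiv.coe_addRight, add_neg_cancel_right]
  rw [abs_sub_comm]
  simp only [and_comm]

theorem Esl_eq_sum (c : EuclideanSpace ℝ (Fin 2) → ℝ) (hc : ∀ z, 0 ≤ c z) (u : ℤ × ℤ → ℝ)
    (A : Set (EuclideanSpace ℝ (Fin 2))) :
    Esl c u A = ∑ d ∈ ({(1, 0), (-1, 0), (0, 1), (0, -1)} : Finset (ℤ × ℤ)),
      ENNReal.ofReal (c (-toR2 d)) * bondVariation u A d := by
  unfold Esl
  have h1 : ∀ x : ℤ × ℤ, (∑' y : ℤ × ℤ,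
      if toR2 x ∈ A ∧ toR2 y ∈ A ∧ ‖toR2 x - toR2 y‖ = 1 then
        ENNReal.ofReal (c (toR2 x - toR2 y) * |u x - u y|) else 0) =
      ∑' d : ℤ × ℤ, if toR2 x ∈ A ∧ toR2 (x + d) ∈ A ∧ ‖toR2 d‖ = 1 then
        ENNReal.ofReal (c (-toR2 d) * |u x - u (x + d)|) else 0 := fun x => by
    rw [← (Equiv.addLeft x).tsum_eq]
    simp only [Equiv.coe_addLeft, toR2_sub_toR2_add, norm_neg]
  simp_rw [h1]
  rw [ENNReal.tsum_comm, tsum_eq_sum (s := {(1, 0), (-1, 0), (0, 1), (0, -1)})]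
  · refine Finset.sum_congr rfl fun d hd => ?_
    rw [bondVariation, ← ENNReal.tsum_mul_left]
    refine tsum_congr fun x => ?_
    simp only [norm_toR2_eq_one_iff.2 hd, and_true]
    split_ifs
    · rw [ENNReal.ofReal_mul (hc _)]
    · simp
  · intro d hd
    rw [← norm_toR2_eq_one_iff] at hd
    simp [hd]

theorem toR2_one_zero : toR2 (1, 0) = EuclideanSpace.single 0 (1 : ℝ) := by
  ext i
  fin_cases i <;> simp [toR2]

theorem toR2_zero_one : toR2 (0, 1) = EuclideanSpace.single 1 (1 : ℝ) := by
  ext i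
  fin_cases i <;> simp [toR2]

theorem toR2_neg (d : ℤ × ℤ) : toR2 (-d) = -toR2 d := by
  ext i
  fin_cases i <;> simp [toR2]

theorem bondVariation_one_zero (u : ℤ × ℤ → ℝ) (ν : EuclideanSpace ℝ (Fin 2)) (t : ℝ) :
    bondVariation u (sqQ ν t) (1, 0) =
      rowVariation (latticeSquare (ν 0) (ν 1) t) (fun x h => u (x, h)) := by
  unfold bondVariation rowVariation
  simp_rw [toR2_mem_sqQ]
  rw [ENNReal.tsum_prod', ENNReal.tsum_comm]
  simp

theorem bondVariation_zero_one (u : ℤ × ℤ → ℝ) (ν : EuclideanSpace ℝ (Fin 2)) (t : ℝ) :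
    bondVariation u (sqQ ν t) (0, 1) =
      rowVariation (latticeSquare (ν 1) (ν 0) t) (fun x h => u (h, x)) := by
  unfold bondVariation rowVariation
  simp_rw [toR2_mem_sqQ, latticeSquare_swap (a := ν 0) (b := ν 1)]
  rw [ENNReal.tsum_prod']
  simp

theorem Esl_eq_rowVariation (c : EuclideanSpace ℝ (Fin 2) → ℝ) (hc : ∀ z, 0 ≤ c z)
    (u : ℤ × ℤ → ℝ) (ν : EuclideanSpace ℝ (Fin 2)) (t : ℝ) :
    Esl c u (sqQ ν t) =
      ENNReal.ofReal (c (EuclideanSpace.single 0 (1 : ℝ)) +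
          c (-EuclideanSpace.single 0 (1 : ℝ))) *
        rowVariation (latticeSquare (ν 0) (ν 1) t) (fun x h => u (x, h)) +
      ENNReal.ofReal (c (EuclideanSpace.single 1 (1 : ℝ)) +
          c (-EuclideanSpace.single 1 (1 : ℝ))) *
        rowVariation (latticeSquare (ν 1) (ν 0) t) (fun x h => u (h, x)) := by
  have n1 : ((-1, 0) : ℤ × ℤ) = -(1, 0) := by simp
  have n2 : ((0, -1) : ℤ × ℤ) = -(0, 1) := by simp
  rw [Esl_eq_sum c hc, Finset.sum_insert (by decide), Finset.sum_insert (by decide),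
    Finset.sum_insert (by decide), Finset.sum_singleton, n1, n2, bondVariation_neg,
    bondVariation_neg, toR2_neg, toR2_neg, toR2_one_zero, toR2_zero_one,
    bondVariation_one_zero, bondVariation_zero_one, neg_neg, neg_neg,
    ENNReal.ofReal_add (hc _) (hc _), ENNReal.ofReal_add (hc _) (hc _)]
  ring

theorem IsPreconnected.exists_mem_frontier {X : Type*} [TopologicalSpace X] {S A : Set X}
    (hS : IsPreconnected S) {x y : X} (hxS : x ∈ S) (hyS : y ∈ S) (hx : x ∈ A) (hy : y ∉ A) :
    ∃ z ∈ S, z ∈ frontier A := by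
  by_contra! hz
  have hsub : S ⊆ interior A ∪ interior Aᶜ := fun z hzS => by
    rw [← compl_frontier_eq_union_interior]
    exact hz z hzS
  obtain ⟨w, -, hw1, hw2⟩ := hS _ _ isOpen_interior isOpen_interior hsub
    ⟨x, hxS, (hsub hxS).resolve_right fun h => interior_subset h hx⟩
    ⟨y, hyS, (hsub hyS).resolve_left fun h => hy (interior_subset h)⟩
  exact interior_subset hw2 (interior_subset hw1)

theorem infDist_frontier_le_dist {E : Type*} [NormedAddCommGroup E] [NormedSpace ℝ E]
    {A : Set E} {x y : E} (hx : x ∈ A) (hy : y ∉ A) :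
    Metric.infDist x (frontier A) ≤ dist x y := by
  obtain ⟨z, hz, hzA⟩ := (convex_segment (𝕜 := ℝ) x y).isPreconnected.exists_mem_frontier
    (left_mem_segment ℝ x y) (right_mem_segment ℝ x y) hx hy
  refine (Metric.infDist_le_dist_of_mem hzA).trans ?_
  have := dist_add_dist_of_mem_segment hz
  linarith [dist_nonneg (x := z) (y := y)]

theorem eq_u0_of_neighbour {ν : EuclideanSpace ℝ (Fin 2)} {t : ℝ} {u : ℤ × ℤ → ℝ}
    (hu : ∀ x : ℤ × ℤ, Metric.infDist (toR2 x) (frontier (sqQ ν t)) ≤ 2 → u x = u0 ν (toR2 x))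
    {x d : ℤ × ℤ} (hd : d ∈ ({(1, 0), (-1, 0), (0, 1), (0, -1)} : Finset (ℤ × ℤ)))
    (hx : latticeSquare (ν 0) (ν 1) t x.1 x.2)
    (hxd : ¬ latticeSquare (ν 0) (ν 1) t (x + d).1 (x + d).2) :
    u x = halfPlane (ν 0) (ν 1) x.1 x.2 := by
  rw [← toR2_mem_sqQ] at hx hxd
  rw [hu x, u0_toR2]
  have h := infDist_frontier_le_dist hx hxd
  rw [dist_eq_norm, toR2_sub_toR2_add, norm_neg, norm_toR2_eq_one_iff.2 hd] at h
  linarith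

theorem mSl_bounds (c : EuclideanSpace ℝ (Fin 2) → ℝ) (hc : ∀ z, 0 ≤ c z)
    {ν : EuclideanSpace ℝ (Fin 2)} (hν : ‖ν‖ = 1) {t : ℝ} (ht : 2 < t) {p q : ℝ}
    (hp : p = c (EuclideanSpace.single 0 (1 : ℝ)) + c (-EuclideanSpace.single 0 (1 : ℝ)))
    (hq : q = c (EuclideanSpace.single 1 (1 : ℝ)) + c (-EuclideanSpace.single 1 (1 : ℝ))) :
    p * (2 * (|ν 0| * t - 5)) + q * (2 * (|ν 1| * t - 5)) ≤ mSl c ν t ∧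
      mSl c ν t ≤ p * (2 * (|ν 0| * t + 3)) + q * (2 * (|ν 1| * t + 3)) := by
  have hp0 : 0 ≤ p := hp ▸ add_nonneg (hc _) (hc _)
  have hq0 : 0 ≤ q := hq ▸ add_nonneg (hc _) (hc _)
  have hab : ν 0 ^ 2 + ν 1 ^ 2 = 1 := by
    rw [EuclideanSpace.norm_eq, Real.sqrt_eq_one, Fin.sum_univ_two] at hν
    simpa using hν
  have hba : ν 1 ^ 2 + ν 0 ^ 2 = 1 := by rw [add_comm, hab]
  have hupper : (⨅ u : {u : ℤ × ℤ → ℝ //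
      (∀ x, u x = 1 ∨ u x = -1) ∧
      ∀ x : ℤ × ℤ, Metric.infDist (toR2 x) (frontier (sqQ ν t)) ≤ 2 →
        u x = u0 ν (toR2 x)}, Esl c u (sqQ ν t)) ≤
      ENNReal.ofReal (p * (2 * (|ν 0| * t + 3)) + q * (2 * (|ν 1| * t + 3))) := by
    refine iInf_le_of_le ⟨fun x => u0 ν (toR2 x), fun x => ?_, fun x _ => rfl⟩ ?_
    · simp only [u0]
      split_ifs <;> simp
    · rw [Esl_eq_rowVariation c hc, ← hp, ← hq, ENNReal.ofReal_add (by positivity) (by positivity),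
        ENNReal.ofReal_mul hp0, ENNReal.ofReal_mul hq0]
      simp only [u0_toR2]
      gcongr
      · exact rowVariation_halfPlane_le hab (by linarith)
      · simp only [← halfPlane_swap (ν 0) (ν 1)]
        exact rowVariation_halfPlane_le hba (by linarith)
  have hlower : ENNReal.ofReal (p * (2 * (|ν 0| * t - 5)) + q * (2 * (|ν 1| * t - 5))) ≤
      (⨅ u : {u : ℤ × ℤ → ℝ //
      (∀ x, u x = 1 ∨ u x = -1) ∧
      ∀ x : ℤ × ℤ, Metric.infDist (toR2 x) (frontier (sqQ ν t)) ≤ 2 →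
        u x = u0 ν (toR2 x)}, Esl c u (sqQ ν t)) := by
    refine le_iInf fun u => ?_
    obtain ⟨u, hu1, hu2⟩ := u
    rw [Esl_eq_rowVariation c hc, ← hp, ← hq]
    refine ENNReal.ofReal_add_le.trans ?_
    rw [ENNReal.ofReal_mul hp0, ENNReal.ofReal_mul hq0]
    gcongr
    · refine le_rowVariation hab ht (fun x h => hu1 _) fun x h hx hx' => ?_
      rcases hx' with hx' | hx'
      · exact eq_u0_of_neighbour hu2 (x := (x, h)) (d := (1, 0)) (by decide) hx (by simpa using hx')
      · exact eq_u0_of_neighbour hu2 (x := (x, h)) (d := (-1, 0)) (by decide) hx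
          (by simpa [← sub_eq_add_neg] using hx')
    · refine le_rowVariation hba ht (fun x h => hu1 _) fun x h hx hx' => ?_
      rw [halfPlane_swap]
      simp only [latticeSquare_swap (a := ν 0) (b := ν 1)] at hx hx'
      rcases hx' with hx' | hx'
      · exact eq_u0_of_neighbour hu2 (x := (h, x)) (d := (0, 1)) (by decide) hx (by simpa using hx')
      · exact eq_u0_of_neighbour hu2 (x := (h, x)) (d := (0, -1)) (by decide) hx
          (by simpa [← sub_eq_add_neg] using hx')
  exact ⟨(ENNReal.ofReal_le_iff_le_toReal (ne_top_of_le_ne_top ENNReal.ofReal_ne_top hupper)).1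
    hlower, ENNReal.toReal_le_of_le_ofReal (by positivity) hupper⟩

/-- **Identification of the slice surface tension**: for every `ν ∈ S¹` the limit
`φ_sl(ν) = lim_{t→∞} m_sl(t)/t` exists and equals
`2(c(e₁)+c(−e₁))|ν₁| + 2(c(e₂)+c(−e₂))|ν₂|`. -/
theorem slice_surface_tension
    (c : EuclideanSpace ℝ (Fin 2) → ℝ)
    (hc_nonneg : ∀ z, 0 ≤ c z)
    (hc_pos : ∀ i : Fin 2, 0 < c (EuclideanSpace.single i (1 : ℝ)) ∧
      0 < c (-EuclideanSpace.single i (1 : ℝ)))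
    (ν : EuclideanSpace ℝ (Fin 2)) (hν : ‖ν‖ = 1) :
    Tendsto (fun t : ℝ => mSl c ν t / t) atTop
      (nhds (2 * (c (EuclideanSpace.single 0 (1 : ℝ)) +
          c (-EuclideanSpace.single 0 (1 : ℝ))) * |ν 0| +
        2 * (c (EuclideanSpace.single 1 (1 : ℝ)) +
          c (-EuclideanSpace.single 1 (1 : ℝ))) * |ν 1|)) := by
  set p := c (EuclideanSpace.single 0 (1 : ℝ)) + c (-EuclideanSpace.single 0 (1 : ℝ)) with hp
  set q := c (EuclideanSpace.single 1 (1 : ℝ)) + c (-EuclideanSpace.single 1 (1 : ℝ)) with hq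
  have hlim : ∀ K : ℝ, Tendsto (fun t : ℝ => 2 * p * |ν 0| + 2 * q * |ν 1| + K / t) atTop
      (nhds (2 * p * |ν 0| + 2 * q * |ν 1|)) := fun K => by
    simpa using (tendsto_const_nhds (x := 2 * p * |ν 0| + 2 * q * |ν 1|)).add
      (tendsto_const_nhds.div_atTop tendsto_id (a := K))
  refine tendsto_of_tendsto_of_tendsto_of_le_of_le' (hlim (-10 * (p + q))) (hlim (6 * (p + q))) ?_ ?_
  all_goals
    filter_upwards [eventually_gt_atTop 2] with t ht
    have ht0 : 0 < t := by linarith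
    obtain ⟨h1, h2⟩ := mSl_bounds c hc_nonneg hν ht hp hq
  · rw [le_div_iff₀ ht0, add_mul, div_mul_cancel₀ _ ht0.ne']
    linarith
  · rw [div_le_iff₀ ht0, add_mul, div_mul_cancel₀ _ ht0.ne']
    linarith
end

section
/- Let λ₀ be such that for all λ ≥ λ₀ the infimal minimizer u_ν^λ = u_{1,ν}^{0,λ} satisfies u_ν^λ(x) = −1 whenever ⟨P₂x, ν⟩ ≥ λ − √2. Then for all n, m ∈ ℕ the configuration u_ν^{λ₀} belongs to M_{m,ν}^{−n, λ₀+n}; that is, E_M(u_ν^{λ₀}, F_{m,ν}) ≤ E_M(v, F_{m,ν}) for every v ∈ A_{m,ν}^{−n, λ₀+n}. -/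
open scoped ENNReal Classical

/-- Membership in the slab `ℤ²_M = ℤ² × {0,…,M}`. -/
def inSlab (M : ℕ) (x : ℤ × ℤ × ℤ) : Prop := 0 ≤ x.2.2 ∧ x.2.2 ≤ (M : ℤ)

/-- The energy `E_M(u,Γ) = ∑_{x ∈ Γ_M} ∑_{y ∈ ℤ²_M} c(x-y)|u(x)-u(y)|`, valued in `[0,∞]`. -/
noncomputable def energyM (M : ℕ) (c : EuclideanSpace ℝ (Fin 3) → ℝ)
    (u : ℤ × ℤ × ℤ → ℝ) (Γ : Set (ℤ × ℤ)) : ℝ≥0∞ :=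
  ∑' x : ℤ × ℤ × ℤ, ∑' y : ℤ × ℤ × ℤ,
    if (x.1, x.2.1) ∈ Γ ∧ inSlab M x ∧ inSlab M y then
      ENNReal.ofReal (c (toR3 x - toR3 y) * |u x - u y|) else 0

/-- A direction `ν ∈ S¹` is rational if both its components are rational numbers. -/
def IsRationalDir (ν : EuclideanSpace ℝ (Fin 2)) : Prop :=
  ∃ a b : ℚ, ν 0 = (a : ℝ) ∧ ν 1 = (b : ℝ)

/-- The `ℤ`-module `ℤ_ν = {z ∈ ℤ² : ⟨z,ν⟩ = 0}`. -/
def Znu (ν : EuclideanSpace ℝ (Fin 2)) : Set (ℤ × ℤ) :=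
  {z | @inner ℝ _ _ (toR2 z) ν = 0}

/-- The set `mℤ_ν` of `m`-fold multiples of elements of `ℤ_ν`. -/
def mZnu (m : ℕ) (ν : EuclideanSpace ℝ (Fin 2)) : Set (ℤ × ℤ) :=
  {z | ∃ w ∈ Znu ν, z = ((m : ℤ) * w.1, (m : ℤ) * w.2)}

/-- `F` is a fundamental domain of `ℤ²/mℤ_ν`: every `z ∈ ℤ²` is uniquely `z₁ + z₂` with
`z₁ ∈ mℤ_ν` and `z₂ ∈ F`. -/
def IsFundDomain (m : ℕ) (ν : EuclideanSpace ℝ (Fin 2)) (F : Set (ℤ × ℤ)) : Prop :=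
  ∀ z : ℤ × ℤ, ∃! w : ℤ × ℤ, w ∈ F ∧ z - w ∈ mZnu m ν

/-- `u : ℤ²_M → {±1}` is `(m,ν)`-periodic. -/
def PeriodicMN (M m : ℕ) (ν : EuclideanSpace ℝ (Fin 2)) (u : ℤ × ℤ × ℤ → ℝ) : Prop :=
  ∀ x : ℤ × ℤ × ℤ, inSlab M x → ∀ z ∈ Znu ν,
    u (x.1 + (m : ℤ) * z.1, x.2.1 + (m : ℤ) * z.2, x.2.2) = u x

/-- The class `A_{m,ν}^{θ,λ}` of `(m,ν)`-periodic `{±1}`-configurations with `u = 1` below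
level `θ` and `u = -1` above level `λ` (levels measured by `⟨P₂·,ν⟩`). -/
def AdmissibleA (M m : ℕ) (ν : EuclideanSpace ℝ (Fin 2)) (θ lam : ℝ)
    (u : ℤ × ℤ × ℤ → ℝ) : Prop :=
  (∀ x, inSlab M x → u x = 1 ∨ u x = -1) ∧
  PeriodicMN M m ν u ∧
  (∀ x, inSlab M x → @inner ℝ _ _ (toR2 (x.1, x.2.1)) ν < θ → u x = 1) ∧
  (∀ x, inSlab M x → lam < @inner ℝ _ _ (toR2 (x.1, x.2.1)) ν → u x = -1)

/-- Membership in the class `M_{m,ν}^{θ,λ}` of minimizers of `E_M(·,F_{m,ν})` in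
`A_{m,ν}^{θ,λ}`. -/
def IsMinA (M : ℕ) (c : EuclideanSpace ℝ (Fin 3) → ℝ) (m : ℕ)
    (ν : EuclideanSpace ℝ (Fin 2)) (θ lam : ℝ) (F : Set (ℤ × ℤ))
    (u : ℤ × ℤ × ℤ → ℝ) : Prop :=
  AdmissibleA M m ν θ lam u ∧
  ∀ v, AdmissibleA M m ν θ lam v → energyM M c u F ≤ energyM M c v F

/-- `u` is the infimal minimizer `u_{m,ν}^{θ,λ}`: the pointwise least element (on the slab)
of the class of minimizers `M_{m,ν}^{θ,λ}`. -/
def IsInfMinA (M : ℕ) (c : EuclideanSpace ℝ (Fin 3) → ℝ) (m : ℕ)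
    (ν : EuclideanSpace ℝ (Fin 2)) (θ lam : ℝ) (F : Set (ℤ × ℤ))
    (u : ℤ × ℤ × ℤ → ℝ) : Prop :=
  IsMinA M c m ν θ lam F u ∧
  ∀ v, IsMinA M c m ν θ lam F v → ∀ x, inSlab M x → u x ≤ v x

theorem exists_isLeast_of_isCompact_of_inf_mem {ι : Type*} {K : Set (ι → ℝ)} (hK : IsCompact K)
    (hne : K.Nonempty) (hinf : ∀ v ∈ K, ∀ w ∈ K, v ⊓ w ∈ K) : ∃ v, IsLeast K v := by
  obtain ⟨v, hvK, hv⟩ := hK.inter_iInter_nonempty (fun i : ι => {v | ∀ w ∈ K, v i ≤ w i})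
    (fun i => by
      simp only [Set.ofPred_forall]
      exact isClosed_iInter fun w => isClosed_iInter fun _ =>
        isClosed_le (continuous_apply i) continuous_const)
    (fun S => by
      induction S using Finset.induction_on with
      | empty => simpa using hne
      | insert a S _ ih =>
        obtain ⟨v, hvK, hv⟩ := ih
        obtain ⟨w, hwK, hw⟩ := hK.exists_isMinOn hne (continuous_apply a).continuousOn
        refine ⟨v ⊓ w, hinf v hvK w hwK, ?_⟩
        simp only [Set.mem_iInter, Set.mem_ofPred_eq] at hv ⊢
        intro i hi z hz
        rcases Finset.mem_insert.1 hi with rfl | hi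
        · exact inf_le_right.trans (hw hz)
        · exact inf_le_left.trans (hv i hi z hz))
  exact ⟨v, hvK, fun w hw i => Set.mem_iInter.1 hv i w hw⟩

theorem abs_inf_sub_inf_add_abs_sup_sub_sup_le (a b a' b' : ℝ) :
    |a ⊓ b - a' ⊓ b'| + |a ⊔ b - a' ⊔ b'| ≤ |a - a'| + |b - b'| := by
  rcases le_total a b with h | h <;> rcases le_total a' b' with h' | h' <;>
    simp only [inf_of_le_left, inf_of_le_right, sup_of_le_left, sup_of_le_right, h, h'] <;>
    rcases abs_cases (a - a') with h1 | h1 <;> rcases abs_cases (b - b') with h2 | h2 <;>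
    rcases abs_cases (a - b') with h3 | h3 <;> rcases abs_cases (b - a') with h4 | h4 <;>
    linarith

/-- The lattice `mℤ_ν` as a subgroup of `ℤ²`. -/
noncomputable def periodLattice (m : ℕ) (ν : EuclideanSpace ℝ (Fin 2)) : AddSubgroup (ℤ × ℤ) where
  carrier := mZnu m ν
  zero_mem' := ⟨0, by simp [Znu, toR2, PiLp.inner_apply], by simp; rfl⟩
  add_mem' := by
    rintro _ _ ⟨a, ha, rfl⟩ ⟨b, hb, rfl⟩
    refine ⟨a + b, ?_, by simp [mul_add]⟩
    simp only [Znu, toR2, PiLp.inner_apply, Set.mem_ofPred_eq, Fin.sum_univ_two] at *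
    simp at *
    linarith
  neg_mem' := by
    rintro _ ⟨a, ha, rfl⟩
    refine ⟨-a, ?_, by simp⟩
    simp only [Znu, toR2, PiLp.inner_apply, Set.mem_ofPred_eq, Fin.sum_univ_two] at *
    simp at *
    linarith

theorem mem_periodLattice {m : ℕ} {ν : EuclideanSpace ℝ (Fin 2)} {z : ℤ × ℤ} :
    z ∈ periodLattice m ν ↔ z ∈ mZnu m ν := Iff.rfl

theorem mem_periodLattice_one {ν : EuclideanSpace ℝ (Fin 2)} {z : ℤ × ℤ} :
    z ∈ periodLattice 1 ν ↔ z ∈ Znu ν := by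
  simp [mem_periodLattice, mZnu]

theorem inner_toR2_add (z w : ℤ × ℤ) (ν : EuclideanSpace ℝ (Fin 2)) :
    inner ℝ (toR2 (z.1 + w.1, z.2 + w.2)) ν = inner ℝ (toR2 z) ν + inner ℝ (toR2 w) ν := by
  simp [toR2, PiLp.inner_apply, Fin.sum_univ_two]
  ring

theorem periodLattice_le_one (m : ℕ) (ν : EuclideanSpace ℝ (Fin 2)) :
    periodLattice m ν ≤ periodLattice 1 ν := by
  rintro _ ⟨a, ha, rfl⟩
  rw [mem_periodLattice_one]
  simp only [Znu, toR2, PiLp.inner_apply, Set.mem_ofPred_eq, Fin.sum_univ_two] at *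
  simp at *
  linear_combination (m : ℝ) * ha

/-- Horizontal translation of a configuration. -/
def hshift (h : ℤ × ℤ) (u : ℤ × ℤ × ℤ → ℝ) (x : ℤ × ℤ × ℤ) : ℝ :=
  u (x.1 + h.1, x.2.1 + h.2, x.2.2)

theorem periodicMN_iff {M m : ℕ} {ν : EuclideanSpace ℝ (Fin 2)} {u : ℤ × ℤ × ℤ → ℝ} :
    PeriodicMN M m ν u ↔ ∀ h ∈ periodLattice m ν, ∀ x, inSlab M x → hshift h u x = u x := by
  constructor
  · rintro hu _ ⟨a, ha, rfl⟩ x hx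
    exact hu x hx a ha
  · intro hu x hx z hz
    exact hu _ ⟨z, hz, rfl⟩ x hx

/-- The energy contribution of the vertical fibre over `z`. -/
noncomputable def fibreEnergy (M : ℕ) (c : EuclideanSpace ℝ (Fin 3) → ℝ)
    (u : ℤ × ℤ × ℤ → ℝ) (z : ℤ × ℤ) : ℝ≥0∞ :=
  ∑' t : ℤ, ∑' y : ℤ × ℤ × ℤ,
    if inSlab M (z.1, z.2, t) ∧ inSlab M y then
      ENNReal.ofReal (c (toR3 (z.1, z.2, t) - toR3 y) * |u (z.1, z.2, t) - u y|) else 0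

theorem energyM_eq_tsum_fibreEnergy (M : ℕ) (c : EuclideanSpace ℝ (Fin 3) → ℝ)
    (u : ℤ × ℤ × ℤ → ℝ) (Γ : Set (ℤ × ℤ)) :
    energyM M c u Γ = ∑' z : Γ, fibreEnergy M c u z := by
  rw [tsum_subtype Γ (fibreEnergy M c u), energyM, ← (Equiv.prodAssoc ℤ ℤ ℤ).tsum_eq,
    ENNReal.tsum_prod']
  refine tsum_congr fun z => ?_
  by_cases hz : z ∈ Γ <;> simp [hz, fibreEnergy, Equiv.prodAssoc]

theorem fibreEnergy_congr {M : ℕ} {c : EuclideanSpace ℝ (Fin 3) → ℝ} {u v : ℤ × ℤ × ℤ → ℝ}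
    (h : ∀ x, inSlab M x → u x = v x) : fibreEnergy M c u = fibreEnergy M c v := by
  funext z
  refine tsum_congr fun t => tsum_congr fun y => ?_
  split_ifs with hxy
  · rw [h _ hxy.1, h _ hxy.2]
  · rfl

theorem energyM_congr {M : ℕ} {c : EuclideanSpace ℝ (Fin 3) → ℝ} {u v : ℤ × ℤ × ℤ → ℝ}
    (h : ∀ x, inSlab M x → u x = v x) (Γ : Set (ℤ × ℤ)) : energyM M c u Γ = energyM M c v Γ := by
  simp only [energyM_eq_tsum_fibreEnergy, fibreEnergy_congr h]

theorem fibreEnergy_hshift (M : ℕ) (c : EuclideanSpace ℝ (Fin 3) → ℝ) (u : ℤ × ℤ × ℤ → ℝ)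
    (h z : ℤ × ℤ) : fibreEnergy M c (hshift h u) z = fibreEnergy M c u (z + h) := by
  refine tsum_congr fun t => ?_
  refine Eq.trans ?_ ((Equiv.addRight ((h.1, h.2, 0) : ℤ × ℤ × ℤ)).tsum_eq _)
  refine tsum_congr fun y => ?_
  have hd : toR3 (z.1 + h.1, z.2 + h.2, t) - toR3 (y + (h.1, h.2, 0))
      = toR3 (z.1, z.2, t) - toR3 y := by
    ext i
    fin_cases i <;> simp [toR3]
  have hy : y + (h.1, h.2, 0) = (y.1 + h.1, y.2.1 + h.2, y.2.2) := by
    ext <;> simp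
  simp only [Equiv.coe_addRight, Prod.fst_add, Prod.snd_add, hd]
  simp only [hshift, hy, inSlab]
  congr

theorem fibreEnergy_periodic {M m : ℕ} {c : EuclideanSpace ℝ (Fin 3) → ℝ}
    {ν : EuclideanSpace ℝ (Fin 2)} {u : ℤ × ℤ × ℤ → ℝ} (hu : PeriodicMN M m ν u)
    {h : ℤ × ℤ} (hh : h ∈ periodLattice m ν) (z : ℤ × ℤ) :
    fibreEnergy M c u (z + h) = fibreEnergy M c u z := by
  rw [← fibreEnergy_hshift, fibreEnergy_congr (periodicMN_iff.1 hu h hh)]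

theorem fibreEnergy_eq_of_mk_eq {M m : ℕ} {c : EuclideanSpace ℝ (Fin 3) → ℝ}
    {ν : EuclideanSpace ℝ (Fin 2)} {u : ℤ × ℤ × ℤ → ℝ} (hu : PeriodicMN M m ν u)
    {z w : ℤ × ℤ} (h : (z : (ℤ × ℤ) ⧸ periodLattice m ν) = w) :
    fibreEnergy M c u z = fibreEnergy M c u w := by
  rw [QuotientAddGroup.eq] at h
  rw [← fibreEnergy_periodic hu h z, add_neg_cancel_left]

/-- The energy per period cell does not depend on the fundamental domain. -/
theorem energyM_eq_tsum_quotient {M m : ℕ} {c : EuclideanSpace ℝ (Fin 3) → ℝ}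
    {ν : EuclideanSpace ℝ (Fin 2)} {u : ℤ × ℤ × ℤ → ℝ} (hu : PeriodicMN M m ν u)
    {F : Set (ℤ × ℤ)} (hF : IsFundDomain m ν F) :
    energyM M c u F = ∑' q : (ℤ × ℤ) ⧸ periodLattice m ν, fibreEnergy M c u q.out := by
  have hbij : Function.Bijective (fun z : F => ((z : ℤ × ℤ) : (ℤ × ℤ) ⧸ periodLattice m ν)) := by
    constructor
    · rintro ⟨z, hz⟩ ⟨w, hw⟩ h
      rw [QuotientAddGroup.eq] at h
      obtain ⟨p, -, hp⟩ := hF w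
      refine Subtype.ext ((hp z ⟨hz, ?_⟩).trans (hp w ⟨hw, ?_⟩).symm)
      · rw [sub_eq_neg_add]; exact h
      · rw [sub_self]; exact (periodLattice m ν).zero_mem
    · intro q
      obtain ⟨p, ⟨hpF, hp⟩, -⟩ := hF q.out
      refine ⟨⟨p, hpF⟩, ?_⟩
      conv_rhs => rw [← QuotientAddGroup.out_eq' q]
      rw [QuotientAddGroup.eq, ← sub_eq_neg_add]
      exact hp
  rw [energyM_eq_tsum_fibreEnergy, ← (Equiv.ofBijective _ hbij).tsum_eq]
  refine tsum_congr fun z => fibreEnergy_eq_of_mk_eq hu ?_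
  rw [QuotientAddGroup.out_eq']
  rfl

theorem energyM_hshift {M m : ℕ} {c : EuclideanSpace ℝ (Fin 3) → ℝ}
    {ν : EuclideanSpace ℝ (Fin 2)} {u : ℤ × ℤ × ℤ → ℝ} (hu : PeriodicMN M m ν u) {h : ℤ × ℤ}
    (hu' : PeriodicMN M m ν (hshift h u)) {F : Set (ℤ × ℤ)} (hF : IsFundDomain m ν F) :
    energyM M c (hshift h u) F = energyM M c u F := by
  rw [energyM_eq_tsum_quotient hu hF, energyM_eq_tsum_quotient hu' hF,
    ← (Equiv.addRight (h : (ℤ × ℤ) ⧸ periodLattice m ν)).tsum_eq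
      (fun q => fibreEnergy M c u q.out)]
  refine tsum_congr fun q => ?_
  rw [fibreEnergy_hshift]
  refine fibreEnergy_eq_of_mk_eq hu ?_
  rw [QuotientAddGroup.out_eq', QuotientAddGroup.mk_add, QuotientAddGroup.out_eq']
  rfl

theorem PeriodicMN.of_one {M : ℕ} {ν : EuclideanSpace ℝ (Fin 2)} {u : ℤ × ℤ × ℤ → ℝ}
    (hu : PeriodicMN M 1 ν u) (m : ℕ) : PeriodicMN M m ν u :=
  periodicMN_iff.2 fun h hh => periodicMN_iff.1 hu h (periodLattice_le_one m ν hh)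

/-- On a cell of `mℤ_ν` the energy of a `ℤ_ν`-periodic configuration is a fixed multiple
of its energy on a cell of `ℤ_ν`. -/
theorem energyM_of_periodic_one {M m : ℕ} {c : EuclideanSpace ℝ (Fin 3) → ℝ}
    {ν : EuclideanSpace ℝ (Fin 2)} {u : ℤ × ℤ × ℤ → ℝ} (hu : PeriodicMN M 1 ν u)
    {F G : Set (ℤ × ℤ)} (hF : IsFundDomain m ν F) (hG : IsFundDomain 1 ν G) :
    energyM M c u F =
      ∑' _ : periodLattice 1 ν ⧸ (periodLattice m ν).addSubgroupOf (periodLattice 1 ν),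
        energyM M c u G := by
  rw [energyM_eq_tsum_quotient hu hG, energyM_eq_tsum_quotient (hu.of_one m) hF, ENNReal.tsum_comm,
    ← ENNReal.tsum_prod,
    ← (AddSubgroup.quotientEquivProdOfLE (periodLattice_le_one m ν)).tsum_eq]
  refine tsum_congr fun q => fibreEnergy_eq_of_mk_eq hu ?_
  rw [QuotientAddGroup.out_eq']
  conv_rhs => rw [← QuotientAddGroup.out_eq' q]
  rfl

theorem AdmissibleA.congr {M m : ℕ} {ν : EuclideanSpace ℝ (Fin 2)} {θ lam : ℝ}
    {u v : ℤ × ℤ × ℤ → ℝ} (hu : AdmissibleA M m ν θ lam u)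
    (h : ∀ x, inSlab M x → u x = v x) : AdmissibleA M m ν θ lam v := by
  obtain ⟨h1, h2, h3, h4⟩ := hu
  refine ⟨fun x hx => h x hx ▸ h1 x hx, fun x hx z hz => ?_, fun x hx => h x hx ▸ h3 x hx,
    fun x hx => h x hx ▸ h4 x hx⟩
  rw [← h x hx, ← h2 x hx z hz]
  exact (h (x.1 + m * z.1, x.2.1 + m * z.2, x.2.2) hx).symm

theorem AdmissibleA.inf {M m : ℕ} {ν : EuclideanSpace ℝ (Fin 2)} {θ lam : ℝ}
    {u v : ℤ × ℤ × ℤ → ℝ} (hu : AdmissibleA M m ν θ lam u) (hv : AdmissibleA M m ν θ lam v) :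
    AdmissibleA M m ν θ lam (u ⊓ v) := by
  refine ⟨fun x hx => ?_, fun x hx z hz => ?_, fun x hx hl => ?_, fun x hx hl => ?_⟩
  · rcases hu.1 x hx with h | h <;> rcases hv.1 x hx with h' | h' <;> simp [h, h']
  · simp [hu.2.1 x hx z hz, hv.2.1 x hx z hz]
  · simp [hu.2.2.1 x hx hl, hv.2.2.1 x hx hl]
  · simp [hu.2.2.2 x hx hl, hv.2.2.2 x hx hl]

theorem AdmissibleA.sup {M m : ℕ} {ν : EuclideanSpace ℝ (Fin 2)} {θ lam : ℝ}
    {u v : ℤ × ℤ × ℤ → ℝ} (hu : AdmissibleA M m ν θ lam u) (hv : AdmissibleA M m ν θ lam v) :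
    AdmissibleA M m ν θ lam (u ⊔ v) := by
  refine ⟨fun x hx => ?_, fun x hx z hz => ?_, fun x hx hl => ?_, fun x hx hl => ?_⟩
  · rcases hu.1 x hx with h | h <;> rcases hv.1 x hx with h' | h' <;> simp [h, h']
  · simp [hu.2.1 x hx z hz, hv.2.1 x hx z hz]
  · simp [hu.2.2.1 x hx hl, hv.2.2.1 x hx hl]
  · simp [hu.2.2.2 x hx hl, hv.2.2.2 x hx hl]

theorem AdmissibleA.hshift {M m : ℕ} {ν : EuclideanSpace ℝ (Fin 2)} {θ lam : ℝ}
    {u : ℤ × ℤ × ℤ → ℝ} (hu : AdmissibleA M m ν θ lam u) (h : ℤ × ℤ) :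
    AdmissibleA M m ν (θ - inner ℝ (toR2 h) ν) (lam - inner ℝ (toR2 h) ν) (hshift h u) := by
  obtain ⟨h1, h2, h3, h4⟩ := hu
  refine ⟨fun x hx => h1 _ hx, fun x hx z hz => ?_, fun x hx hl => h3 _ hx ?_,
    fun x hx hl => h4 _ hx ?_⟩
  · have := h2 (x.1 + h.1, x.2.1 + h.2, x.2.2) hx z hz
    simpa only [_root_.hshift, add_right_comm] using this
  · have := inner_toR2_add (x.1, x.2.1) h ν
    simp only at this ⊢
    linarith
  · have := inner_toR2_add (x.1, x.2.1) h ν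
    simp only at this ⊢
    linarith

theorem AdmissibleA.mono {M m : ℕ} {ν : EuclideanSpace ℝ (Fin 2)} {θ θ' lam lam' : ℝ}
    {u : ℤ × ℤ × ℤ → ℝ} (hu : AdmissibleA M m ν θ lam u) (hθ : θ' ≤ θ) (hlam : lam ≤ lam') :
    AdmissibleA M m ν θ' lam' u :=
  ⟨hu.1, hu.2.1, fun x hx hl => hu.2.2.1 x hx (hl.trans_le hθ),
    fun x hx hl => hu.2.2.2 x hx (hlam.trans_lt hl)⟩

theorem energyM_inf_add_sup_le (M : ℕ) {c : EuclideanSpace ℝ (Fin 3) → ℝ} (hc : ∀ z, 0 ≤ c z)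
    (u v : ℤ × ℤ × ℤ → ℝ) (Γ : Set (ℤ × ℤ)) :
    energyM M c (u ⊓ v) Γ + energyM M c (u ⊔ v) Γ ≤ energyM M c u Γ + energyM M c v Γ := by
  simp only [energyM, ← ENNReal.tsum_add]
  refine ENNReal.tsum_le_tsum fun x => ENNReal.tsum_le_tsum fun y => ?_
  split_ifs
  · rw [← ENNReal.ofReal_add, ← ENNReal.ofReal_add, ← mul_add, ← mul_add]
    · exact ENNReal.ofReal_le_ofReal (mul_le_mul_of_nonneg_left
        (abs_inf_sub_inf_add_abs_sup_sub_sup_le _ _ _ _) (hc _))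
    all_goals exact mul_nonneg (hc _) (abs_nonneg _)
  · simp

theorem IsMinA.inf {M m : ℕ} {c : EuclideanSpace ℝ (Fin 3) → ℝ} (hc : ∀ z, 0 ≤ c z)
    {ν : EuclideanSpace ℝ (Fin 2)} {θ lam : ℝ} {F : Set (ℤ × ℤ)} {u v : ℤ × ℤ × ℤ → ℝ}
    (hu : IsMinA M c m ν θ lam F u) (hv : IsMinA M c m ν θ lam F v) :
    IsMinA M c m ν θ lam F (u ⊓ v) := by
  refine ⟨hu.1.inf hv.1, fun w hw => le_trans ?_ (hu.2 w hw)⟩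
  have hsub := energyM_inf_add_sup_le M hc u v F
  have hsup := hv.2 _ (hu.1.sup hv.1)
  rcases eq_or_ne (energyM M c u F) ⊤ with htop | htop
  · simp [htop]
  · have hv_ne : energyM M c v F ≠ ⊤ := ne_top_of_le_ne_top htop (hv.2 u hu.1)
    exact (ENNReal.add_le_add_iff_right hv_ne).1 ((add_le_add_right hsup _).trans hsub)

theorem lowerSemicontinuous_energyM (M : ℕ) (c : EuclideanSpace ℝ (Fin 3) → ℝ)
    (Γ : Set (ℤ × ℤ)) : LowerSemicontinuous fun u => energyM M c u Γ := by
  refine lowerSemicontinuous_tsum fun x => lowerSemicontinuous_tsum fun y => ?_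
  split_ifs
  · refine Continuous.lowerSemicontinuous ?_
    exact ENNReal.continuous_ofReal.comp (by fun_prop)
  · exact lowerSemicontinuous_const

theorem isCompact_admissibleA (M m : ℕ) (ν : EuclideanSpace ℝ (Fin 2)) (θ lam : ℝ) :
    IsCompact {u | AdmissibleA M m ν θ lam u ∧ ∀ x, ¬ inSlab M x → u x = 1} := by
  have hpi : IsCompact (Set.univ.pi fun _ : ℤ × ℤ × ℤ => ({1, -1} : Set ℝ)) :=
    isCompact_univ_pi fun _ => (Set.toFinite _).isCompact
  refine hpi.of_isClosed_subset ?_ fun u hu x _ => ?_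
  · have heq (x : ℤ × ℤ × ℤ) (a : ℝ) : IsClosed {u : ℤ × ℤ × ℤ → ℝ | u x = a} :=
      isClosed_eq (continuous_apply x) continuous_const
    simp only [AdmissibleA, PeriodicMN, Set.ofPred_and, Set.ofPred_forall, Set.ofPred_or]
    refine .inter (.inter ?_ (.inter ?_ (.inter ?_ ?_))) ?_
    · exact isClosed_iInter fun x => isClosed_iInter fun _ => (heq x 1).union (heq x (-1))
    · exact isClosed_iInter fun x => isClosed_iInter fun _ => isClosed_iInter fun z =>
        isClosed_iInter fun _ => isClosed_eq (continuous_apply _) (continuous_apply _)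
    · exact isClosed_iInter fun x => isClosed_iInter fun _ => isClosed_iInter fun _ => heq x 1
    · exact isClosed_iInter fun x => isClosed_iInter fun _ => isClosed_iInter fun _ => heq x (-1)
    · exact isClosed_iInter fun x => isClosed_iInter fun _ => heq x 1
  · by_cases hx : inSlab M x
    · simpa using hu.1.1 x hx
    · simp [hu.2 x hx]

theorem exists_isInfMinA {M m : ℕ} {c : EuclideanSpace ℝ (Fin 3) → ℝ} (hc : ∀ z, 0 ≤ c z)
    {ν : EuclideanSpace ℝ (Fin 2)} {θ lam : ℝ} (F : Set (ℤ × ℤ)) {v : ℤ × ℤ × ℤ → ℝ}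
    (hv : AdmissibleA M m ν θ lam v) : ∃ w, IsInfMinA M c m ν θ lam F w := by
  set A := {u | AdmissibleA M m ν θ lam u ∧ ∀ x, ¬ inSlab M x → u x = 1}
  have hA : IsCompact A := isCompact_admissibleA M m ν θ lam
  let ext1 (u : ℤ × ℤ × ℤ → ℝ) (x : ℤ × ℤ × ℤ) : ℝ := if inSlab M x then u x else 1
  have hext (u : ℤ × ℤ × ℤ → ℝ) (x) (hx : inSlab M x) : u x = ext1 u x := by simp [ext1, hx]
  have hextA {u} (hu : AdmissibleA M m ν θ lam u) : ext1 u ∈ A :=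
    ⟨hu.congr (hext u), fun x hx => by simp [ext1, hx]⟩
  have hlsc := lowerSemicontinuous_energyM M c F
  obtain ⟨e, heA, he⟩ := LowerSemicontinuousOn.exists_isMinOn ⟨_, hextA hv⟩ hA
    (hlsc.lowerSemicontinuousOn A)
  have hemin : IsMinA M c m ν θ lam F e :=
    ⟨heA.1, fun w hw => energyM_congr (hext w) F ▸ he (hextA hw)⟩
  have hiff (u) (hu : u ∈ A) :
      energyM M c u F ≤ energyM M c e F ↔ IsMinA M c m ν θ lam F u :=
    ⟨fun h => ⟨hu.1, fun w hw => h.trans (hemin.2 w hw)⟩, fun h => h.2 e heA.1⟩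
  set K := A ∩ (fun u => energyM M c u F) ⁻¹' Set.Iic (energyM M c e F)
  obtain ⟨w, hwK, hw⟩ := exists_isLeast_of_isCompact_of_inf_mem (K := K)
    (hA.inter_right (hlsc.isClosed_preimage _)) ⟨e, heA, le_refl (energyM M c e F)⟩
    (fun a ha b hb => by
      have hab : a ⊓ b ∈ A := ⟨ha.1.1.inf hb.1.1, fun x hx => by
        simp [ha.1.2 x hx, hb.1.2 x hx]⟩
      exact ⟨hab, (hiff _ hab).2 (((hiff a ha.1).1 ha.2).inf hc ((hiff b hb.1).1 hb.2))⟩)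
  refine ⟨w, (hiff w hwK.1).1 hwK.2, fun z hz x hx => ?_⟩
  rw [hext z x hx]
  refine hw ⟨hextA hz.1, ?_⟩ x
  exact (energyM_congr (hext z) F).symm.trans_le (hz.2 e heA.1)

/-- Absence of period doubling: infimal minimizers are `ℤ_ν`-periodic. -/
theorem IsInfMinA.periodic_one {M m : ℕ} {c : EuclideanSpace ℝ (Fin 3) → ℝ}
    {ν : EuclideanSpace ℝ (Fin 2)} {θ lam : ℝ} {F : Set (ℤ × ℤ)} (hF : IsFundDomain m ν F)
    {w : ℤ × ℤ × ℤ → ℝ} (hw : IsInfMinA M c m ν θ lam F w) : PeriodicMN M 1 ν w := by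
  have hle : ∀ h ∈ periodLattice 1 ν, ∀ x, inSlab M x → w x ≤ hshift h w x := by
    intro h hh x hx
    have h0 : inner ℝ (toR2 h) ν = 0 := mem_periodLattice_one.1 hh
    have hadm := hw.1.1.hshift h
    rw [h0, sub_zero, sub_zero] at hadm
    refine hw.2 _ ⟨hadm, fun z hz => ?_⟩ x hx
    rw [energyM_hshift hw.1.1.2.1 hadm.2.1 hF]
    exact hw.1.2 z hz
  refine periodicMN_iff.2 fun h hh x hx => le_antisymm ?_ (hle h hh x hx)
  have := hle (-h) (neg_mem hh) (x.1 + h.1, x.2.1 + h.2, x.2.2) hx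
  simpa [hshift] using this

theorem exists_inner_toR2_le {ν : EuclideanSpace ℝ (Fin 2)} (hν : ν ≠ 0) (r : ℝ) :
    ∃ h : ℤ × ℤ, inner ℝ (toR2 h) ν ≤ r := by
  have key (a : ℝ) (ha : a ≠ 0) : ∃ k : ℤ, k * a ≤ r := by
    rcases lt_or_gt_of_ne ha with ha | ha
    · obtain ⟨k, hk⟩ := exists_int_gt (r / a)
      exact ⟨k, ((div_lt_iff_of_neg ha).1 hk).le⟩
    · obtain ⟨k, hk⟩ := exists_int_lt (r / a)
      exact ⟨k, ((lt_div_iff₀ ha).1 hk).le⟩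
  have : ν 0 ≠ 0 ∨ ν 1 ≠ 0 := by
    by_contra! h
    exact hν (by ext i; fin_cases i <;> simp [h])
  rcases this with h | h
  · obtain ⟨k, hk⟩ := key _ h
    exact ⟨(k, 0), by simpa [toR2, PiLp.inner_apply, Fin.sum_univ_two, mul_comm] using hk⟩
  · obtain ⟨k, hk⟩ := key _ h
    exact ⟨(0, k), by simpa [toR2, PiLp.inner_apply, Fin.sum_univ_two, mul_comm] using hk⟩

/-- **Unconstrained minimality of `u_ν^{λ₀}`** (Lemma A.9): if for all `λ ≥ λ₀` the infimal
minimizer `u_{1,ν}^{0,λ}` satisfies `u = -1` where `⟨P₂x,ν⟩ ≥ λ - √2`, then the infimal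
minimizer `u_ν^{λ₀}` belongs to `M_{m,ν}^{-n,λ₀+n}` for all `n, m ∈ ℕ`, i.e. it minimizes
`E_M(·,F_{m,ν})` among all `v ∈ A_{m,ν}^{-n,λ₀+n}`. -/
theorem infimal_minimizer_wider_classes
    (L Cbar c0 : ℝ) (hL : 0 < L) (hCbar : 0 < Cbar) (hc0 : 0 < c0)
    (c : EuclideanSpace ℝ (Fin 3) → ℝ)
    (hc_nonneg : ∀ z, 0 ≤ c z)
    (hc_bd : ∀ z, c z ≤ Cbar)
    (hc_range : ∀ z : EuclideanSpace ℝ (Fin 3), L ≤ ‖z‖ → c z = 0)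
    (hc_coer : ∀ i : Fin 3,
      c0 ≤ c (EuclideanSpace.single i (1 : ℝ)) ∧ c0 ≤ c (-EuclideanSpace.single i (1 : ℝ)))
    (M : ℕ)
    (ν : EuclideanSpace ℝ (Fin 2)) (hν : ‖ν‖ = 1) (hrat : IsRationalDir ν)
    (lam0 : ℝ) (hlam0 : 0 < lam0)
    (hminus : ∀ lam : ℝ, lam0 ≤ lam →
      ∀ F : Set (ℤ × ℤ), IsFundDomain 1 ν F →
        ∀ u : ℤ × ℤ × ℤ → ℝ, IsInfMinA M c 1 ν 0 lam F u →
          ∀ x : ℤ × ℤ × ℤ, inSlab M x →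
            lam - Real.sqrt 2 ≤ @inner ℝ _ _ (toR2 (x.1, x.2.1)) ν → u x = -1)
    (F1 : Set (ℤ × ℤ)) (hF1 : IsFundDomain 1 ν F1)
    (u : ℤ × ℤ × ℤ → ℝ) (hu : IsInfMinA M c 1 ν 0 lam0 F1 u) :
    ∀ n m : ℕ, 0 < m → ∀ Fm : Set (ℤ × ℤ), IsFundDomain m ν Fm →
      ∀ v : ℤ × ℤ × ℤ → ℝ, AdmissibleA M m ν (-(n : ℝ)) (lam0 + n) v →
        energyM M c u Fm ≤ energyM M c v Fm := by
  intro n m hm Fm hFm v hv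
  have hmin : ∀ k : ℕ, ∀ w, AdmissibleA M 1 ν 0 (lam0 + k) w →
      energyM M c u F1 ≤ energyM M c w F1 := by
    intro k
    induction k with
    | zero => simpa using hu.1.2
    | succ k ih =>
      intro w hw
      obtain ⟨w', hw'⟩ := exists_isInfMinA hc_nonneg F1 hw
      refine (ih w' ⟨hw'.1.1.1, hw'.1.1.2.1, hw'.1.1.2.2.1, fun x hx hl => ?_⟩).trans (hw'.1.2 w hw)
      have hsqrt : (1 : ℝ) ≤ √2 := Real.one_le_sqrt.2 one_le_two
      refine hminus (lam0 + (k + 1 : ℕ)) (le_add_of_nonneg_right (Nat.cast_nonneg _))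
        F1 hF1 w' hw' x hx ?_
      push_cast
      linarith
  obtain ⟨h, hh⟩ := exists_inner_toR2_le (norm_ne_zero_iff.1 (hν ▸ one_ne_zero)) (-(n : ℝ))
  obtain ⟨k, hk⟩ := exists_nat_ge ((n : ℝ) - inner ℝ (toR2 h) ν)
  have hshift_adm : AdmissibleA M m ν 0 (lam0 + k) (hshift h v) :=
    (hv.hshift h).mono (by linarith) (by linarith)
  obtain ⟨w, hw⟩ := exists_isInfMinA hc_nonneg Fm hshift_adm
  have hw_one := hw.periodic_one hFm
  rw [← energyM_hshift hv.2.1 hshift_adm.2.1 hFm]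
  refine le_trans ?_ (hw.1.2 _ hshift_adm)
  rw [energyM_of_periodic_one hu.1.1.2.1 hFm hF1, energyM_of_periodic_one hw_one hFm hF1]
  exact ENNReal.tsum_le_tsum fun _ =>
    hmin k w ⟨hw.1.1.1, hw_one, hw.1.1.2.2.1, hw.1.1.2.2.2⟩
end
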